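/- For every f ∈ C²_poly(ℝⁿ), the function u(x) = ∫₀^∞ e^{−t} P_t f(x) dt is well defined and solves the resolvent equation δ·∇ u(x) + u(x) = f(x) for all x ∈ ℝⁿ. -/

import Mathlib

open MeasureTheory Real
open scoped RealInnerProductSpace BigOperators

noncomputable section

/-- The standard Gaussian measure on `ℝⁿ`, with density
`(2π)^(-n/2) exp(-|x|²/2)` with respect to Lebesgue measure. -/
def gaussianMeasure (n : ℕ) : Measure (EuclideanSpace ℝ (Fin n)) :=
  volume.withDensity fun x => ENNReal.ofReal ((2 * π) ^ (-(n : ℝ) / 2) * Real.exp (-‖x‖ ^ 2 / 2))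

/-- `C^k_poly(ℝⁿ)`: `C^k` functions which, together with all derivatives up to
order `k`, are bounded by a polynomial. -/
def CPoly (k n : ℕ) (f : EuclideanSpace ℝ (Fin n) → ℝ) : Prop :=
  ContDiff ℝ k f ∧
    ∀ i, i ≤ k → ∃ (C : ℝ) (m : ℕ), ∀ x, ‖iteratedFDeriv ℝ i f x‖ ≤ C * (1 + ‖x‖) ^ m

/-- The `i`-th partial derivative. -/
def partialDeriv {n : ℕ} (i : Fin n) (f : EuclideanSpace ℝ (Fin n) → ℝ)
    (x : EuclideanSpace ℝ (Fin n)) : ℝ :=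
  fderiv ℝ f x (EuclideanSpace.single i 1)

/-- The Laplacian. -/
def laplacian {n : ℕ} (f : EuclideanSpace ℝ (Fin n) → ℝ) (x : EuclideanSpace ℝ (Fin n)) : ℝ :=
  ∑ i : Fin n, partialDeriv i (partialDeriv i f) x

/-- The Ornstein–Uhlenbeck operator `δ·∇ f (x) = x·∇f(x) − Δf(x)`. -/
def ouOperator {n : ℕ} (f : EuclideanSpace ℝ (Fin n) → ℝ) (x : EuclideanSpace ℝ (Fin n)) : ℝ :=
  ⟪x, gradient f x⟫ - laplacian f x

/-- The Ornstein–Uhlenbeck semigroup given by the Mehler formula. -/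
def ouSemigroup (n : ℕ) (t : ℝ) (f : EuclideanSpace ℝ (Fin n) → ℝ)
    (x : EuclideanSpace ℝ (Fin n)) : ℝ :=
  ∫ y, f (Real.exp (-t) • x + Real.sqrt (1 - Real.exp (-2 * t)) • y) ∂gaussianMeasure n

/-- A Young function: the primitive of a continuous, strictly increasing function
`φ` with `φ(0) = 0` and `φ(u) → ∞`. -/
def IsYoung (Φ : ℝ → ℝ) : Prop :=
  ∃ φ : ℝ → ℝ, ContinuousOn φ (Set.Ici 0) ∧ StrictMonoOn φ (Set.Ici 0) ∧ φ 0 = 0 ∧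
    Filter.Tendsto φ Filter.atTop Filter.atTop ∧
    ∀ x, 0 ≤ x → Φ x = ∫ u in (0:ℝ)..x, φ u

/-- The Luxemburg norm of `f` in the Orlicz space `L_Φ(γ)` over the Gaussian space. -/
def luxNorm (n : ℕ) (Φ : ℝ → ℝ) (f : EuclideanSpace ℝ (Fin n) → ℝ) : ℝ :=
  sInf {α : ℝ | 0 < α ∧ ∫ x, Φ (|f x| / α) ∂gaussianMeasure n ≤ 1}

end

noncomputable section

variable {n : ℕ}

local notation "𝔼" => EuclideanSpace ℝ (Fin n)

/-- Functions of at most polynomial growth. -/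
def HasPolyGrowth {G : Type*} [NormedAddCommGroup G] (F : EuclideanSpace ℝ (Fin n) → G) : Prop :=
  ∃ (C : ℝ) (m : ℕ), ∀ x, ‖F x‖ ≤ C * (1 + ‖x‖) ^ m

/-- The density of the standard Gaussian measure. -/
def gaussianDensity (y : EuclideanSpace ℝ (Fin n)) : ℝ :=
  (2 * π) ^ (-(n : ℝ) / 2) * Real.exp (-‖y‖ ^ 2 / 2)

/-- The point at which the Mehler formula evaluates a function. -/
def mehlerPoint (t : ℝ) (x y : EuclideanSpace ℝ (Fin n)) : EuclideanSpace ℝ (Fin n) :=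
  Real.exp (-t) • x + √(1 - Real.exp (-2 * t)) • y

section Gaussian

theorem gaussianDensity_nonneg (y : 𝔼) : 0 ≤ gaussianDensity y := by
  unfold gaussianDensity; positivity

theorem measurable_ofReal_gaussianDensity :
    Measurable fun y : 𝔼 => ENNReal.ofReal (gaussianDensity y) := by
  unfold gaussianDensity; fun_prop

theorem integrable_gaussianMeasure_iff {G : Type*} [NormedAddCommGroup G] [NormedSpace ℝ G]
    {F : 𝔼 → G} :
    Integrable F (gaussianMeasure n) ↔ Integrable (fun y => gaussianDensity y • F y) := by
  refine (integrable_withDensity_iff_integrable_smul' measurable_ofReal_gaussianDensity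
    (by simp)).trans ?_
  simp only [ENNReal.toReal_ofReal (gaussianDensity_nonneg _)]

theorem integral_gaussianMeasure {G : Type*} [NormedAddCommGroup G] [NormedSpace ℝ G]
    (F : 𝔼 → G) : ∫ y, F y ∂gaussianMeasure n = ∫ y, gaussianDensity y • F y := by
  refine (integral_withDensity_eq_integral_toReal_smul measurable_ofReal_gaussianDensity
    (by simp) F).trans ?_
  simp only [ENNReal.toReal_ofReal (gaussianDensity_nonneg _)]

theorem integrable_exp_neg_mul_sq_norm {b : ℝ} (hb : 0 < b) :
    Integrable fun y : 𝔼 => Real.exp (-b * ‖y‖ ^ 2) := by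
  by_contra h
  have h1 := GaussianFourier.integral_rexp_neg_mul_sq_norm (V := 𝔼) hb
  rw [integral_undef h] at h1
  have : 0 < (π / b) ^ ((Module.finrank ℝ 𝔼 : ℝ) / 2) := by positivity
  linarith

theorem integrable_one_add_norm_pow (m : ℕ) :
    Integrable (fun y : 𝔼 => (1 + ‖y‖) ^ m) (gaussianMeasure n) := by
  rw [integrable_gaussianMeasure_iff]
  refine ((integrable_exp_neg_mul_sq_norm (n := n) (b := 1 / 4) (by norm_num)).const_mul
    ((2 * π) ^ (-(n : ℝ) / 2) * (m.factorial * Real.exp 2))).mono'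
    (by unfold gaussianDensity; fun_prop) (.of_forall fun y => ?_)
  have h1 : (1 + ‖y‖) ^ m ≤ m.factorial * Real.exp (1 + ‖y‖) := by
    have := Real.pow_div_factorial_le_exp (1 + ‖y‖) (by positivity) m
    rwa [div_le_iff₀' (by positivity)] at this
  have h2 : Real.exp (-‖y‖ ^ 2 / 2) * Real.exp (1 + ‖y‖) ≤
      Real.exp 2 * Real.exp (-(1 / 4) * ‖y‖ ^ 2) := by
    rw [← Real.exp_add, ← Real.exp_add, Real.exp_le_exp]
    nlinarith [sq_nonneg (‖y‖ - 2)]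
  rw [norm_smul, Real.norm_of_nonneg (gaussianDensity_nonneg y), Real.norm_of_nonneg (by positivity)]
  calc gaussianDensity y * (1 + ‖y‖) ^ m
      ≤ gaussianDensity y * (m.factorial * Real.exp (1 + ‖y‖)) :=
        mul_le_mul_of_nonneg_left h1 (gaussianDensity_nonneg y)
    _ = (2 * π) ^ (-(n : ℝ) / 2) * m.factorial *
          (Real.exp (-‖y‖ ^ 2 / 2) * Real.exp (1 + ‖y‖)) := by unfold gaussianDensity; ring
    _ ≤ (2 * π) ^ (-(n : ℝ) / 2) * m.factorial *
          (Real.exp 2 * Real.exp (-(1 / 4) * ‖y‖ ^ 2)) := by gcongr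
    _ = _ := by ring

instance isProbabilityMeasure_gaussianMeasure : IsProbabilityMeasure (gaussianMeasure n) := by
  have hfin : IsFiniteMeasure (gaussianMeasure n) := by
    have := integrable_one_add_norm_pow (n := n) 0
    simpa [integrable_const_iff] using this
  have h : ∫ _ : 𝔼, (1 : ℝ) ∂gaussianMeasure n = 1 := by
    rw [integral_gaussianMeasure]
    have h1 := GaussianFourier.integral_rexp_neg_mul_sq_norm (V := 𝔼) (b := 1 / 2) (by norm_num)
    have h2 : ∀ y : 𝔼, gaussianDensity y • (1 : ℝ) =
        (2 * π) ^ (-(n : ℝ) / 2) * Real.exp (-(1 / 2) * ‖y‖ ^ 2) := fun y => by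
      rw [gaussianDensity, smul_eq_mul, mul_one]; congr 2; ring
    simp only [h2]
    rw [integral_const_mul, h1, finrank_euclideanSpace_fin, show π / (1 / 2) = 2 * π by ring,
      ← Real.rpow_add (by positivity)]
    ring_nf
    simp
  simp only [integral_const, smul_eq_mul, mul_one] at h
  exact ⟨by rwa [measureReal_def, ENNReal.toReal_eq_one_iff] at h⟩

theorem HasPolyGrowth.integrable {G : Type*} [NormedAddCommGroup G] [NormedSpace ℝ G]
    {F : 𝔼 → G} (hF : HasPolyGrowth F) (hc : Continuous F) :
    Integrable F (gaussianMeasure n) := by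
  obtain ⟨C, m, h⟩ := hF
  exact ((integrable_one_add_norm_pow m).const_mul C).mono' hc.aestronglyMeasurable (.of_forall h)

theorem HasPolyGrowth.mul_inner {F : 𝔼 → ℝ} (hF : HasPolyGrowth F) (v : 𝔼) :
    HasPolyGrowth fun y => F y * ⟪y, v⟫ := by
  obtain ⟨C, m, h⟩ := hF
  refine ⟨C * ‖v‖, m + 1, fun y => ?_⟩
  rw [norm_mul]
  calc ‖F y‖ * ‖⟪y, v⟫‖ ≤ (C * (1 + ‖y‖) ^ m) * ((1 + ‖y‖) * ‖v‖) := by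
        refine mul_le_mul (h y) ((norm_inner_le_norm y v).trans ?_) (norm_nonneg _)
          ((norm_nonneg _).trans (h y))
        gcongr; linarith
    _ = _ := by ring

theorem hasFDerivAt_gaussianDensity (y : 𝔼) :
    HasFDerivAt gaussianDensity (-gaussianDensity y • innerSL ℝ y) y := by
  have h := (((hasStrictFDerivAt_norm_sq y).hasFDerivAt.neg.mul_const (1 / 2 : ℝ)).exp.const_mul
    ((2 * π) ^ (-(n : ℝ) / 2)))
  refine (h.congr_of_eventuallyEq (.of_forall fun z => ?_)).congr_fderiv ?_
  · simp [gaussianDensity, div_eq_mul_inv]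
  · ext v
    simp [gaussianDensity, div_eq_mul_inv]
    ring

/-- Gaussian integration by parts. -/
theorem integral_mul_inner_gaussianMeasure {F : 𝔼 → ℝ} (hF : ContDiff ℝ 1 F)
    (h0 : HasPolyGrowth F) (h1 : HasPolyGrowth (fderiv ℝ F)) (v : 𝔼) :
    ∫ y, F y * ⟪y, v⟫ ∂gaussianMeasure n = ∫ y, fderiv ℝ F y v ∂gaussianMeasure n := by
  have hc1 : Continuous (fderiv ℝ F) := hF.continuous_fderiv one_ne_zero
  have i0 : Integrable (fun y => F y * gaussianDensity y) := by
    simpa [mul_comm] using integrable_gaussianMeasure_iff.1 (h0.integrable hF.continuous)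
  have i1 : Integrable (fun y => fderiv ℝ F y v * gaussianDensity y) := by
    simpa [mul_comm] using integrable_gaussianMeasure_iff.1
      (ContinuousLinearMap.integrable_comp (ContinuousLinearMap.apply ℝ ℝ v) (h1.integrable hc1))
  have i2 : Integrable (fun y => F y * fderiv ℝ gaussianDensity y v) := by
    have := (integrable_gaussianMeasure_iff.1
      ((h0.mul_inner v).integrable (hF.continuous.mul (by fun_prop)))).neg
    refine this.congr (.of_forall fun y => ?_)
    simp [(hasFDerivAt_gaussianDensity y).fderiv]
    ring
  have := integral_mul_fderiv_eq_neg_fderiv_mul_of_integrable i1 i2 i0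
    (fun x _ => (hF.differentiable one_ne_zero) x)
    (fun x _ => (hasFDerivAt_gaussianDensity x).differentiableAt)
  rw [integral_gaussianMeasure, integral_gaussianMeasure]
  calc _ = -∫ y, F y * fderiv ℝ gaussianDensity y v := by
        rw [← integral_neg]
        refine integral_congr_ae (.of_forall fun y => ?_)
        simp [(hasFDerivAt_gaussianDensity y).fderiv]
        ring
    _ = _ := by rw [this, neg_neg]; simp only [smul_eq_mul, mul_comm]

end Gaussian

section Growth

variable {G : Type*} [NormedAddCommGroup G]

theorem norm_mehlerPoint_le {t : ℝ} (ht : 0 ≤ t) (x y : 𝔼) : ‖mehlerPoint t x y‖ ≤ ‖x‖ + ‖y‖ := by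
  have ha : Real.exp (-t) ≤ 1 := Real.exp_le_one_iff.2 (by linarith)
  have hb : √(1 - Real.exp (-2 * t)) ≤ 1 := by
    exact Real.sqrt_le_iff.2 ⟨zero_le_one, by linarith [Real.exp_pos (-2 * t)]⟩
  refine (norm_add_le _ _).trans ?_
  rw [norm_smul, norm_smul, Real.norm_of_nonneg (Real.exp_pos _).le,
    Real.norm_of_nonneg (Real.sqrt_nonneg _)]
  exact add_le_add (mul_le_of_le_one_left (norm_nonneg _) ha)
    (mul_le_of_le_one_left (norm_nonneg _) hb)

theorem continuous_mehlerPoint :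
    Continuous fun p : ℝ × 𝔼 × 𝔼 => mehlerPoint p.1 p.2.1 p.2.2 := by
  unfold mehlerPoint; fun_prop

theorem HasPolyGrowth.exists_bound_mehlerPoint {F : 𝔼 → G} (hF : HasPolyGrowth F) :
    ∃ (C : ℝ) (m : ℕ), 0 ≤ C ∧ ∀ t, 0 ≤ t → ∀ x y,
      ‖F (mehlerPoint t x y)‖ ≤ C * (1 + ‖x‖) ^ m * (1 + ‖y‖) ^ m := by
  obtain ⟨C, m, h⟩ := hF
  have hC : 0 ≤ C := by simpa using (norm_nonneg _).trans (h 0)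
  refine ⟨C, m, hC, fun t ht x y => (h _).trans ?_⟩
  rw [mul_assoc, ← mul_pow]
  gcongr
  nlinarith [norm_mehlerPoint_le ht x y, norm_nonneg x, norm_nonneg y,
    mul_nonneg (norm_nonneg x) (norm_nonneg y)]

theorem HasPolyGrowth.comp_mehlerPoint {F : 𝔼 → G} (hF : HasPolyGrowth F) {t : ℝ} (ht : 0 ≤ t)
    (x : 𝔼) : HasPolyGrowth fun y => F (mehlerPoint t x y) := by
  obtain ⟨C, m, -, h⟩ := hF.exists_bound_mehlerPoint
  exact ⟨C * (1 + ‖x‖) ^ m, m, h t ht x⟩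

theorem HasPolyGrowth.const_smul [NormedSpace ℝ G] {F : 𝔼 → G} (hF : HasPolyGrowth F) (c : ℝ) :
    HasPolyGrowth fun y => c • F y := by
  obtain ⟨C, m, h⟩ := hF
  refine ⟨‖c‖ * C, m, fun y => ?_⟩
  rw [norm_smul, mul_assoc]
  exact mul_le_mul_of_nonneg_left (h y) (norm_nonneg c)

theorem HasPolyGrowth.clm_apply [NormedSpace ℝ G] {T : 𝔼 → 𝔼 →L[ℝ] G} (hT : HasPolyGrowth T) (v : 𝔼) :
    HasPolyGrowth fun y => T y v := by
  obtain ⟨C, m, h⟩ := hT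
  refine ⟨C * ‖v‖, m, fun y => ((T y).le_opNorm v).trans ?_⟩
  rw [mul_right_comm]
  exact mul_le_mul_of_nonneg_right (h y) (norm_nonneg v)

/-- `C¹` functions which are of polynomial growth together with their derivative. -/
structure IsC1Poly (F : EuclideanSpace ℝ (Fin n) → ℝ) : Prop where
  contDiff : ContDiff ℝ 1 F
  growth : HasPolyGrowth F
  growth_fderiv : HasPolyGrowth (fderiv ℝ F)

theorem IsC1Poly.continuous_fderiv {F : 𝔼 → ℝ} (hF : IsC1Poly F) : Continuous (fderiv ℝ F) :=
  hF.contDiff.continuous_fderiv one_ne_zero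

theorem IsC1Poly.hasFDerivAt {F : 𝔼 → ℝ} (hF : IsC1Poly F) (x : 𝔼) :
    HasFDerivAt F (fderiv ℝ F x) x :=
  (hF.contDiff.differentiable one_ne_zero x).hasFDerivAt

theorem IsC1Poly.continuous_partialDeriv {F : 𝔼 → ℝ} (hF : IsC1Poly F) (i : Fin n) :
    Continuous (partialDeriv i F) :=
  hF.continuous_fderiv.clm_apply continuous_const

theorem IsC1Poly.growth_partialDeriv {F : 𝔼 → ℝ} (hF : IsC1Poly F) (i : Fin n) :
    HasPolyGrowth (partialDeriv i F) :=
  hF.growth_fderiv.clm_apply _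

theorem CPoly.isC1Poly {f : 𝔼 → ℝ} (hf : CPoly 2 n f) : IsC1Poly f where
  contDiff := hf.1.of_le (by norm_num)
  growth := by simpa [HasPolyGrowth] using hf.2 0 (by norm_num)
  growth_fderiv := by simpa [HasPolyGrowth] using hf.2 1 (by norm_num)

theorem CPoly.isC1Poly_partialDeriv {f : 𝔼 → ℝ} (hf : CPoly 2 n f) (i : Fin n) :
    IsC1Poly (partialDeriv i f) := by
  have h1 : ContDiff ℝ 1 (fderiv ℝ f) := hf.1.fderiv_right (by norm_num)
  refine ⟨h1.clm_apply contDiff_const, hf.isC1Poly.growth_partialDeriv i, ?_⟩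
  obtain ⟨C, m, h⟩ := hf.2 2 le_rfl
  refine ⟨C, m, fun x => le_trans ?_ (h x)⟩
  have h2 : HasFDerivAt (partialDeriv i f)
      ((ContinuousLinearMap.apply ℝ ℝ (EuclideanSpace.single i (1 : ℝ))).comp
        (fderiv ℝ (fderiv ℝ f) x)) x :=
    (ContinuousLinearMap.apply ℝ ℝ (EuclideanSpace.single i (1 : ℝ))).hasFDerivAt.comp x
      (h1.differentiable one_ne_zero x).hasFDerivAt
  rw [h2.fderiv, ← norm_iteratedFDeriv_fderiv, norm_iteratedFDeriv_one]
  refine ContinuousLinearMap.opNorm_le_bound _ (norm_nonneg _) fun v => ?_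
  refine ((fderiv ℝ (fderiv ℝ f) x v).le_opNorm _).trans ?_
  simpa using (fderiv ℝ (fderiv ℝ f) x).le_opNorm v

end Growth

section Resolvent

/-- Lebesgue measure on `(0, ∞)` times the standard Gaussian measure. -/
def timeGaussian (n : ℕ) : Measure (ℝ × EuclideanSpace ℝ (Fin n)) :=
  (volume.restrict (Set.Ioi 0)).prod (gaussianMeasure n)

theorem ae_timeGaussian_pos : ∀ᵐ p ∂timeGaussian n, 0 < p.1 :=
  Measure.quasiMeasurePreserving_fst.ae (ae_restrict_mem measurableSet_Ioi)

theorem integrableOn_mul_exp_neg {c : ℝ → ℝ} (hc : IntegrableOn c (Set.Ioi 0)) :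
    IntegrableOn (fun t => c t * Real.exp (-t)) (Set.Ioi 0) := by
  refine hc.norm.mono' (hc.aestronglyMeasurable.mul (by fun_prop)) ?_
  filter_upwards [ae_restrict_mem measurableSet_Ioi] with t ht
  rw [norm_mul, Real.norm_of_nonneg (Real.exp_pos _).le]
  exact mul_le_of_le_one_right (norm_nonneg _) (Real.exp_le_one_iff.2 (by simpa using ht.le))

theorem aestronglyMeasurable_mehlerPoint {G : Type*} [NormedAddCommGroup G] [NormedSpace ℝ G]
    {c : ℝ → ℝ} (hc : IntegrableOn c (Set.Ioi 0)) {F : 𝔼 → G} (hF : Continuous F) (x : 𝔼) :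
    AEStronglyMeasurable (fun p : ℝ × 𝔼 => c p.1 • F (mehlerPoint p.1 x p.2))
      (timeGaussian n) := by
  refine (hc.aestronglyMeasurable.comp_fst).smul (Continuous.aestronglyMeasurable ?_)
  exact hF.comp (continuous_mehlerPoint.comp (by fun_prop :
    Continuous fun p : ℝ × 𝔼 => (p.1, x, p.2)))

theorem integrable_bound_timeGaussian {c : ℝ → ℝ} (hc : IntegrableOn c (Set.Ioi 0))
    (K : ℝ) (m : ℕ) :
    Integrable (fun p : ℝ × 𝔼 => ‖c p.1‖ * (K * (1 + ‖p.2‖) ^ m)) (timeGaussian n) :=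
  hc.norm.mul_prod ((integrable_one_add_norm_pow m).const_mul K)

theorem integrable_mehlerPoint {G : Type*} [NormedAddCommGroup G] [NormedSpace ℝ G]
    {c : ℝ → ℝ} (hc : IntegrableOn c (Set.Ioi 0)) {F : 𝔼 → G} (hF : Continuous F)
    (hg : HasPolyGrowth F) (x : 𝔼) :
    Integrable (fun p : ℝ × 𝔼 => c p.1 • F (mehlerPoint p.1 x p.2)) (timeGaussian n) := by
  obtain ⟨C, m, -, h⟩ := hg.exists_bound_mehlerPoint
  refine (integrable_bound_timeGaussian hc (C * (1 + ‖x‖) ^ m) m).mono'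
    (aestronglyMeasurable_mehlerPoint hc hF x) ?_
  filter_upwards [ae_timeGaussian_pos] with p hp
  rw [norm_smul]
  exact mul_le_mul_of_nonneg_left (h _ hp.le _ _) (norm_nonneg _)

theorem hasFDerivAt_integral_mehlerPoint {c : ℝ → ℝ} (hc : IntegrableOn c (Set.Ioi 0))
    {F : 𝔼 → ℝ} (hF : IsC1Poly F) (x : 𝔼) :
    HasFDerivAt (fun z => ∫ p, c p.1 * F (mehlerPoint p.1 z p.2) ∂timeGaussian n)
      (∫ p, (c p.1 * Real.exp (-p.1)) • fderiv ℝ F (mehlerPoint p.1 x p.2) ∂timeGaussian n) x := by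
  obtain ⟨C, m, hC, h⟩ := hF.growth_fderiv.exists_bound_mehlerPoint
  have hc' := integrableOn_mul_exp_neg hc
  refine hasFDerivAt_integral_of_dominated_of_fderiv_le (Metric.ball_mem_nhds x one_pos)
    (F' := fun z p => (c p.1 * Real.exp (-p.1)) • fderiv ℝ F (mehlerPoint p.1 z p.2))
    (.of_forall fun z => aestronglyMeasurable_mehlerPoint hc hF.contDiff.continuous z)
    (integrable_mehlerPoint hc hF.contDiff.continuous hF.growth x)
    (aestronglyMeasurable_mehlerPoint hc' hF.continuous_fderiv x) ?_
    (integrable_bound_timeGaussian hc' (C * (2 + ‖x‖) ^ m) m) (.of_forall fun p z _ => ?_)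
  · filter_upwards [ae_timeGaussian_pos] with p hp z hz
    rw [norm_smul]
    refine mul_le_mul_of_nonneg_left ((h _ hp.le _ _).trans ?_) (norm_nonneg _)
    have : ‖z‖ ≤ 1 + ‖x‖ := by
      have h1 := norm_le_norm_add_norm_sub x z
      rw [Metric.mem_ball, dist_eq_norm] at hz
      linarith [norm_sub_rev x z]
    gcongr ?_ * ?_ ^ m * _
    linarith
  · have hM : HasFDerivAt (fun z => mehlerPoint p.1 z p.2)
        (Real.exp (-p.1) • ContinuousLinearMap.id ℝ 𝔼) z :=
      ((hasFDerivAt_id z).const_smul (Real.exp (-p.1))).add_const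
        (√(1 - Real.exp (-2 * p.1)) • p.2)
    refine (((hF.hasFDerivAt _).comp z hM).const_mul (c p.1)).congr_fderiv ?_
    ext v
    simp [mul_assoc]

theorem partialDeriv_integral_mehlerPoint {c : ℝ → ℝ} (hc : IntegrableOn c (Set.Ioi 0))
    {F : 𝔼 → ℝ} (hF : IsC1Poly F) (i : Fin n) :
    partialDeriv i (fun z => ∫ p, c p.1 * F (mehlerPoint p.1 z p.2) ∂timeGaussian n) =
      fun z => ∫ p, (c p.1 * Real.exp (-p.1)) * partialDeriv i F (mehlerPoint p.1 z p.2)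
        ∂timeGaussian n := by
  funext z
  rw [partialDeriv, (hasFDerivAt_integral_mehlerPoint hc hF z).fderiv,
    ContinuousLinearMap.integral_apply (integrable_mehlerPoint (integrableOn_mul_exp_neg hc)
      hF.continuous_fderiv hF.growth_fderiv z)]
  rfl

end Resolvent

section TimeDerivative

theorem sum_smul_single (y : 𝔼) : ∑ i, y i • EuclideanSpace.single i (1 : ℝ) = y := by
  simpa using (EuclideanSpace.basisFun (Fin n) ℝ).sum_repr y

theorem fderiv_apply_eq_sum (f : 𝔼 → ℝ) (z y : 𝔼) :
    fderiv ℝ f z y = ∑ i, y i * partialDeriv i f z := by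
  conv_lhs => rw [← sum_smul_single y]
  simp [partialDeriv]

theorem hasFDerivAt_mehlerPoint_right (t : ℝ) (x y : 𝔼) :
    HasFDerivAt (mehlerPoint t x) (√(1 - Real.exp (-2 * t)) • ContinuousLinearMap.id ℝ 𝔼) y :=
  ((hasFDerivAt_id y).const_smul (√(1 - Real.exp (-2 * t)))).const_add (Real.exp (-t) • x)

theorem continuous_mehlerPoint_right (t : ℝ) (x : 𝔼) : Continuous (mehlerPoint t x) :=
  continuous_iff_continuousAt.2 fun y => (hasFDerivAt_mehlerPoint_right t x y).continuousAt

theorem IsC1Poly.fderiv_comp_mehlerPoint {F : 𝔼 → ℝ} (hF : IsC1Poly F) (t : ℝ) (x y : 𝔼) :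
    fderiv ℝ (fun y => F (mehlerPoint t x y)) y =
      √(1 - Real.exp (-2 * t)) • fderiv ℝ F (mehlerPoint t x y) := by
  have := (hF.hasFDerivAt _).comp y (hasFDerivAt_mehlerPoint_right t x y)
  refine HasFDerivAt.fderiv (this.congr_fderiv ?_)
  ext v
  simp

theorem IsC1Poly.comp_mehlerPoint {F : 𝔼 → ℝ} (hF : IsC1Poly F) {t : ℝ} (ht : 0 ≤ t) (x : 𝔼) :
    IsC1Poly fun y => F (mehlerPoint t x y) where
  contDiff := hF.contDiff.comp (by unfold mehlerPoint; fun_prop)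
  growth := hF.growth.comp_mehlerPoint ht x
  growth_fderiv := by
    simpa only [funext (hF.fderiv_comp_mehlerPoint t x)] using
      (hF.growth_fderiv.comp_mehlerPoint ht x).const_smul _

theorem integral_mul_coord_mehlerPoint {F : 𝔼 → ℝ} (hF : IsC1Poly F) {t : ℝ} (ht : 0 ≤ t)
    (x : 𝔼) (i : Fin n) :
    ∫ y, y i * F (mehlerPoint t x y) ∂gaussianMeasure n =
      √(1 - Real.exp (-2 * t)) *
        ∫ y, partialDeriv i F (mehlerPoint t x y) ∂gaussianMeasure n := by
  have hM := hF.comp_mehlerPoint ht x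
  have := integral_mul_inner_gaussianMeasure hM.contDiff hM.growth hM.growth_fderiv
    (EuclideanSpace.single i 1)
  simp only [hF.fderiv_comp_mehlerPoint, smul_apply, smul_eq_mul,
    integral_const_mul] at this
  simpa [EuclideanSpace.inner_single_right, mul_comm, partialDeriv] using this

theorem integrable_mul_coord_mehlerPoint {F : 𝔼 → ℝ} (hF : IsC1Poly F) {t : ℝ} (ht : 0 ≤ t)
    (x : 𝔼) (i : Fin n) :
    Integrable (fun y => y i * F (mehlerPoint t x y)) (gaussianMeasure n) := by
  have hM := hF.comp_mehlerPoint ht x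
  have := (hM.growth.mul_inner (EuclideanSpace.single i 1)).integrable
    (hM.contDiff.continuous.mul (by fun_prop))
  simpa [EuclideanSpace.inner_single_right, mul_comm] using this

theorem CPoly.integrable_laplacian_mehlerPoint {f : 𝔼 → ℝ} (hf : CPoly 2 n f) {t : ℝ}
    (ht : 0 ≤ t) (x : 𝔼) :
    Integrable (fun y => laplacian f (mehlerPoint t x y)) (gaussianMeasure n) :=
  integrable_finsetSum _ fun i _ =>
    (((hf.isC1Poly_partialDeriv i).growth_partialDeriv i).comp_mehlerPoint ht x).integrable
      (((hf.isC1Poly_partialDeriv i).continuous_partialDeriv i).comp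
        (continuous_mehlerPoint_right t x))

theorem IsC1Poly.integrable_fderiv_mehlerPoint {F : 𝔼 → ℝ} (hF : IsC1Poly F) {t : ℝ}
    (ht : 0 ≤ t) (x v : 𝔼) :
    Integrable (fun y => fderiv ℝ F (mehlerPoint t x y) v) (gaussianMeasure n) :=
  ((hF.growth_fderiv.clm_apply v).comp_mehlerPoint ht x).integrable
    ((hF.continuous_fderiv.clm_apply continuous_const).comp (continuous_mehlerPoint_right t x))

theorem CPoly.integral_fderiv_mehlerPoint_self {f : 𝔼 → ℝ} (hf : CPoly 2 n f) {t : ℝ}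
    (ht : 0 ≤ t) (x : 𝔼) :
    ∫ y, fderiv ℝ f (mehlerPoint t x y) y ∂gaussianMeasure n =
      √(1 - Real.exp (-2 * t)) * ∫ y, laplacian f (mehlerPoint t x y) ∂gaussianMeasure n := by
  simp only [laplacian, fderiv_apply_eq_sum]
  rw [integral_finsetSum _ fun i _ =>
      integrable_mul_coord_mehlerPoint (hf.isC1Poly_partialDeriv i) ht x i,
    integral_finsetSum _ fun i _ =>
      (((hf.isC1Poly_partialDeriv i).growth_partialDeriv i).comp_mehlerPoint ht x).integrable
        (((hf.isC1Poly_partialDeriv i).continuous_partialDeriv i).comp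
          (continuous_mehlerPoint_right t x)), Finset.mul_sum]
  exact Finset.sum_congr rfl fun i _ =>
    integral_mul_coord_mehlerPoint (hf.isC1Poly_partialDeriv i) ht x i

theorem hasDerivAt_mehlerPoint {t : ℝ} (ht : 0 < t) (x y : 𝔼) :
    HasDerivAt (fun s => mehlerPoint s x y)
      (-Real.exp (-t) • x + (Real.exp (-2 * t) / √(1 - Real.exp (-2 * t))) • y) t := by
  have hpos : 1 - Real.exp (-2 * t) ≠ 0 := by
    have : Real.exp (-2 * t) < 1 := Real.exp_lt_one_iff.2 (by linarith)
    linarith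
  have h1 : HasDerivAt (fun s : ℝ => Real.exp (-s)) (-Real.exp (-t)) t := by
    simpa using (hasDerivAt_neg t).exp
  have h2 : HasDerivAt (fun s : ℝ => √(1 - Real.exp (-2 * s)))
      (Real.exp (-2 * t) / √(1 - Real.exp (-2 * t))) t := by
    have h := ((((hasDerivAt_id t).const_mul (-2)).exp.const_sub 1).sqrt hpos)
    refine h.congr_deriv ?_
    simp only [id]
    field_simp
  exact (h1.smul_const x).add (h2.smul_const y)

theorem IsC1Poly.hasDerivAt_ouSemigroup {f : 𝔼 → ℝ} (hf : IsC1Poly f) {t : ℝ} (ht : 0 < t)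
    (x : 𝔼) :
    Integrable (fun y => fderiv ℝ f (mehlerPoint t x y)
      (-Real.exp (-t) • x + (Real.exp (-2 * t) / √(1 - Real.exp (-2 * t))) • y))
        (gaussianMeasure n) ∧
    HasDerivAt (fun s => ouSemigroup n s f x)
      (∫ y, fderiv ℝ f (mehlerPoint t x y)
        (-Real.exp (-t) • x + (Real.exp (-2 * t) / √(1 - Real.exp (-2 * t))) • y)
        ∂gaussianMeasure n) t := by
  obtain ⟨C, m, hC, h⟩ := hf.growth_fderiv.exists_bound_mehlerPoint
  set K : ℝ := 1 / √(1 - Real.exp (-t)) with hK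
  have hK0 : 0 ≤ K := by positivity
  have hpos : 0 < 1 - Real.exp (-t) := by
    have : Real.exp (-t) < 1 := Real.exp_lt_one_iff.2 (by linarith)
    linarith
  refine hasDerivAt_integral_of_dominated_loc_of_deriv_le
    (F := fun s y => f (mehlerPoint s x y))
    (F' := fun s y => fderiv ℝ f (mehlerPoint s x y)
      (-Real.exp (-s) • x + (Real.exp (-2 * s) / √(1 - Real.exp (-2 * s))) • y))
    (bound := fun y => C * (1 + ‖x‖) ^ m * (‖x‖ + K) * (1 + ‖y‖) ^ (m + 1))
    (Ioi_mem_nhds (half_lt_self ht))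
    (.of_forall fun s =>
      (hf.contDiff.continuous.comp (continuous_mehlerPoint_right s x)).aestronglyMeasurable)
    ((hf.comp_mehlerPoint ht.le x).growth.integrable
      (hf.contDiff.continuous.comp (continuous_mehlerPoint_right t x)))
    (Continuous.aestronglyMeasurable ?_) (.of_forall fun y s hs => ?_)
    ((integrable_one_add_norm_pow (m + 1)).const_mul _) (.of_forall fun y s hs => ?_)
  · exact (hf.continuous_fderiv.comp (continuous_mehlerPoint_right t x)).clm_apply (by fun_prop)
  · have hs' : t / 2 < s := hs
    have hs0 : 0 < s := by linarith
    have ha : ‖-Real.exp (-s) • x‖ ≤ ‖x‖ := by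
      rw [norm_smul, norm_neg, Real.norm_of_nonneg (Real.exp_pos _).le]
      exact mul_le_of_le_one_left (norm_nonneg _) (Real.exp_le_one_iff.2 (by linarith))
    have hb : ‖(Real.exp (-2 * s) / √(1 - Real.exp (-2 * s))) • y‖ ≤ K * ‖y‖ := by
      rw [norm_smul, Real.norm_of_nonneg (by positivity), hK]
      gcongr
      · exact Real.exp_le_one_iff.2 (by linarith)
      · linarith
    refine ((fderiv ℝ f _).le_opNorm _).trans ?_
    calc _ ≤ (C * (1 + ‖x‖) ^ m * (1 + ‖y‖) ^ m) * ((‖x‖ + K) * (1 + ‖y‖)) := by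
          refine mul_le_mul (h s hs0.le x y) ((norm_add_le _ _).trans ?_) (norm_nonneg _)
            (by positivity)
          nlinarith [norm_nonneg x, norm_nonneg y, mul_nonneg (norm_nonneg x) (norm_nonneg y)]
      _ = _ := by ring
  · have hs0 : 0 < s := (half_pos ht).trans hs
    exact (hf.hasFDerivAt _).comp_hasDerivAt s (hasDerivAt_mehlerPoint hs0 x y)

/-- The Kolmogorov equation for the Ornstein–Uhlenbeck semigroup. -/
theorem CPoly.hasDerivAt_ouSemigroup {f : 𝔼 → ℝ} (hf : CPoly 2 n f) {t : ℝ} (ht : 0 < t)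
    (x : 𝔼) :
    HasDerivAt (fun s => ouSemigroup n s f x)
      (Real.exp (-t) * Real.exp (-t) * ∫ y, laplacian f (mehlerPoint t x y) ∂gaussianMeasure n -
        Real.exp (-t) * ∫ y, fderiv ℝ f (mehlerPoint t x y) x ∂gaussianMeasure n) t := by
  obtain ⟨hintegrable, h⟩ := hf.isC1Poly.hasDerivAt_ouSemigroup ht x
  refine h.congr_deriv ?_
  have hpos : 0 < 1 - Real.exp (-2 * t) := by
    have : Real.exp (-2 * t) < 1 := Real.exp_lt_one_iff.2 (by linarith)
    linarith
  have hx := hf.isC1Poly.integrable_fderiv_mehlerPoint ht.le x x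
  have hy : Integrable (fun y => Real.exp (-2 * t) / √(1 - Real.exp (-2 * t)) *
      fderiv ℝ f (mehlerPoint t x y) y) (gaussianMeasure n) := by
    refine (hintegrable.add (hx.const_mul (Real.exp (-t)))).congr (.of_forall fun y => ?_)
    simp
  simp only [map_add, map_smul, smul_eq_mul]
  rw [integral_add (hx.const_mul _) hy, integral_const_mul, integral_const_mul,
    hf.integral_fderiv_mehlerPoint_self ht.le, ← mul_assoc,
    div_mul_cancel₀ _ (Real.sqrt_pos.2 hpos).ne', ← Real.exp_add]
  ring_nf

theorem HasPolyGrowth.exists_bound_ouSemigroup {f : 𝔼 → ℝ} (hf : HasPolyGrowth f) (x : 𝔼) :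
    ∃ K, ∀ t, 0 ≤ t → ‖ouSemigroup n t f x‖ ≤ K := by
  obtain ⟨C, m, -, h⟩ := hf.exists_bound_mehlerPoint
  exact ⟨_, fun t ht => norm_integral_le_of_norm_le
    ((integrable_one_add_norm_pow m).const_mul _) (.of_forall (h t ht x))⟩

theorem HasPolyGrowth.continuousWithinAt_ouSemigroup {f : 𝔼 → ℝ} (hf : HasPolyGrowth f)
    (hc : Continuous f) (x : 𝔼) :
    ContinuousWithinAt (fun t => ouSemigroup n t f x) (Set.Ici 0) 0 := by
  obtain ⟨C, m, -, h⟩ := hf.exists_bound_mehlerPoint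
  refine continuousWithinAt_of_dominated (F := fun t y => f (mehlerPoint t x y))
    (.of_forall fun t => (hc.comp (continuous_mehlerPoint_right t x)).aestronglyMeasurable)
    (Filter.eventually_of_mem self_mem_nhdsWithin fun t ht => .of_forall (h t ht x))
    ((integrable_one_add_norm_pow m).const_mul _) (.of_forall fun y => ?_)
  exact (hc.comp (continuous_mehlerPoint.comp
    (by fun_prop : Continuous fun t : ℝ => (t, x, y)))).continuousWithinAt

theorem ouSemigroup_zero (f : 𝔼 → ℝ) (x : 𝔼) : ouSemigroup n 0 f x = f x := by
  simp [ouSemigroup]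

end TimeDerivative

end

/-- The resolvent formula: `u(x) = ∫₀^∞ e^{−t} P_t f(x) dt` is well defined and
solves `δ·∇ u + u = f`. -/
theorem ou_resolvent (n : ℕ) (f : EuclideanSpace ℝ (Fin n) → ℝ) (hf : CPoly 2 n f) :
    (∀ x, IntegrableOn (fun t => Real.exp (-t) * ouSemigroup n t f x) (Set.Ioi 0)) ∧
      ∀ x, ouOperator
            (fun y => ∫ t in Set.Ioi (0 : ℝ), Real.exp (-t) * ouSemigroup n t f y) x +
          (∫ t in Set.Ioi (0 : ℝ), Real.exp (-t) * ouSemigroup n t f x) = f x := by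
  have hf1 := hf.isC1Poly
  have hc1 : IntegrableOn (fun t : ℝ => Real.exp (-t)) (Set.Ioi 0) := integrableOn_exp_neg_Ioi 0
  have hc2 := integrableOn_mul_exp_neg hc1
  have hc3 := integrableOn_mul_exp_neg hc2
  have i0 (x) := integrable_mehlerPoint hc1 hf1.contDiff.continuous hf1.growth x
  have i1 (x) := integrable_mehlerPoint hc2 (hf1.continuous_fderiv.clm_apply continuous_const)
    (hf1.growth_fderiv.clm_apply x) x
  have i2 (x) (i) := integrable_mehlerPoint hc3
    ((hf.isC1Poly_partialDeriv i).continuous_partialDeriv i)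
    ((hf.isC1Poly_partialDeriv i).growth_partialDeriv i) x
  simp only [smul_eq_mul] at i0 i1 i2
  have i2' (x) : Integrable (fun p : ℝ × EuclideanSpace ℝ (Fin n) =>
      Real.exp (-p.1) * Real.exp (-p.1) * Real.exp (-p.1) * laplacian f (mehlerPoint p.1 x p.2))
      (timeGaussian n) := by
    simp only [laplacian, Finset.mul_sum]
    exact integrable_finsetSum _ fun i _ => i2 x i
  have hslice (t : ℝ) (x) : Real.exp (-t) * ouSemigroup n t f x =
      ∫ y, Real.exp (-t) * f (mehlerPoint t x y) ∂gaussianMeasure n :=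
    (integral_const_mul _ _).symm
  have hu : (fun x => ∫ t in Set.Ioi (0 : ℝ), Real.exp (-t) * ouSemigroup n t f x) =
      fun x => ∫ p, Real.exp (-p.1) * f (mehlerPoint p.1 x p.2) ∂timeGaussian n := by
    funext x
    simp only [hslice]
    exact (integral_prod _ (i0 x)).symm
  refine ⟨fun x => ?_, fun x => ?_⟩
  · simp only [hslice]
    exact (i0 x).integral_prod_left
  have hgrad : ⟪x, gradient (fun z => ∫ p, Real.exp (-p.1) * f (mehlerPoint p.1 z p.2)
      ∂timeGaussian n) x⟫ = ∫ p, Real.exp (-p.1) * Real.exp (-p.1) *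
        fderiv ℝ f (mehlerPoint p.1 x p.2) x ∂timeGaussian n := by
    rw [real_inner_comm, gradient, InnerProductSpace.toDual_symm_apply,
      (hasFDerivAt_integral_mehlerPoint hc1 hf1 x).fderiv,
      ContinuousLinearMap.integral_apply
        (integrable_mehlerPoint hc2 hf1.continuous_fderiv hf1.growth_fderiv x)]
    rfl
  have hlap : laplacian (fun z => ∫ p, Real.exp (-p.1) * f (mehlerPoint p.1 z p.2)
      ∂timeGaussian n) x = ∫ p, Real.exp (-p.1) * Real.exp (-p.1) * Real.exp (-p.1) *
        laplacian f (mehlerPoint p.1 x p.2) ∂timeGaussian n := by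
    simp only [laplacian, partialDeriv_integral_mehlerPoint hc1 hf1,
      partialDeriv_integral_mehlerPoint hc2 (hf.isC1Poly_partialDeriv _), Finset.mul_sum]
    exact (integral_finsetSum _ fun i _ => i2 x i).symm
  have hintegrable := ((i1 x).sub (i2' x)).add (i0 x)
  rw [hu, ouOperator, hgrad, hlap, congrFun hu x, ← integral_sub' (i1 x) (i2' x),
    ← integral_add' ((i1 x).sub (i2' x)) (i0 x)]
  refine (integral_prod _ hintegrable).trans ?_
  have hderiv : ∀ t ∈ Set.Ioi (0 : ℝ),
      HasDerivAt (fun t => -(Real.exp (-t) * ouSemigroup n t f x))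
        (∫ y, (Real.exp (-t) * Real.exp (-t) * fderiv ℝ f (mehlerPoint t x y) x -
          Real.exp (-t) * Real.exp (-t) * Real.exp (-t) * laplacian f (mehlerPoint t x y) +
          Real.exp (-t) * f (mehlerPoint t x y)) ∂gaussianMeasure n) t := by
    intro t ht
    have ht0 : 0 ≤ t := le_of_lt ht
    have h1 : HasDerivAt (fun s : ℝ => Real.exp (-s)) (-Real.exp (-t)) t := by
      simpa using (hasDerivAt_neg t).exp
    refine (h1.mul (hf.hasDerivAt_ouSemigroup ht x)).neg.congr_deriv ?_
    have j1 := (hf1.integrable_fderiv_mehlerPoint ht0 x x).const_mul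
      (Real.exp (-t) * Real.exp (-t))
    have j2 := (hf.integrable_laplacian_mehlerPoint ht0 x).const_mul
      (Real.exp (-t) * Real.exp (-t) * Real.exp (-t))
    have j0 := ((hf1.growth.comp_mehlerPoint ht0 x).integrable
      (hf1.contDiff.continuous.comp (continuous_mehlerPoint_right t x))).const_mul (Real.exp (-t))
    rw [integral_add (by exact j1.sub j2) j0, integral_sub j1 j2, integral_const_mul,
      integral_const_mul, integral_const_mul]
    change _ = _ + Real.exp (-t) * ouSemigroup n t f x
    ring
  have hlim : Filter.Tendsto (fun t => -(Real.exp (-t) * ouSemigroup n t f x)) Filter.atTop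
      (nhds 0) := by
    obtain ⟨K, hK⟩ := hf1.growth.exists_bound_ouSemigroup x
    refine squeeze_zero_norm' (a := fun t => Real.exp (-t) * K) ?_ ?_
    · filter_upwards [Filter.eventually_ge_atTop 0] with t ht
      rw [norm_neg, norm_mul, Real.norm_of_nonneg (Real.exp_pos _).le]
      exact mul_le_mul_of_nonneg_left (hK t ht) (Real.exp_pos _).le
    · simpa using (Real.tendsto_exp_neg_atTop_nhds_zero).mul_const K
  refine (integral_Ioi_of_hasDerivAt_of_tendsto ?_ hderiv hintegrable.integral_prod_left hlim).trans ?_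
  · exact ((by fun_prop : Continuous fun t : ℝ => Real.exp (-t)).continuousWithinAt.mul
      (hf1.growth.continuousWithinAt_ouSemigroup hf1.contDiff.continuous x)).neg
  · simp [ouSemigroup_zero]
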